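/- Let X ⊆ ℝ^d be compact and let {K_n}_{n=1}^N, with N ≥ 2, be compact subsets of ℝ^d satisfying: (a) each K_n has nonempty interior and int(K_n) ∩ int(K_m) = ∅ whenever n ≠ m; (b) for every n ≤ N there exists ñ ≤ N with ñ ≠ n and K_n ∩ K_ñ ≠ ∅; (c) the closure of int(K_n) equals K_n for every n. Then for every δ > 0 there exist an index n ≠ 1 with K_1 ∩ K_n ≠ ∅, vectors c_1, c_n ∈ ℝ^D, such that the function f_δ := c_1·1_{int(K_1)} + c_n·1_{int(K_n)} satisfies: every continuous function f : ℝ^d → ℝ^D whose support is contained in K_1 ∪ K_n obeys sup_{x ∈ ⋃_{k=1}^N K_k} ‖f(x) − f_δ(x)‖ ≥ δ. -/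

import Mathlib

/-- If the closures of two sets meet, then a continuous function cannot be close to two
distant constants on both sets. -/
theorem norm_sub_le_two_mul_of_mem_closure {E F : Type*} [TopologicalSpace E]
    [SeminormedAddCommGroup F] {f : E → F} (hf : Continuous f) {A B : Set E} {a b : F} {s : ℝ}
    (hA : ∀ x ∈ A, ‖f x - a‖ ≤ s) (hB : ∀ x ∈ B, ‖f x - b‖ ≤ s) {x : E}
    (hxA : x ∈ closure A) (hxB : x ∈ closure B) : ‖a - b‖ ≤ 2 * s := by
  have extend (C : Set E) (c : F) (hC : ∀ y ∈ C, ‖f y - c‖ ≤ s) (hx : x ∈ closure C) :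
      ‖f x - c‖ ≤ s :=
    closure_minimal (t := {y | ‖f y - c‖ ≤ s}) hC
      (isClosed_le (hf.sub continuous_const).norm continuous_const) hx
  have h₁ := extend A a hA hxA
  have h₂ := extend B b hB hxB
  have h₃ := norm_sub_le (f x - b) (f x - a)
  rw [sub_sub_sub_cancel_left] at h₃
  linarith

/-- A real supremum over a set on which a nonnegative function is bounded dominates its values. -/
theorem Real.le_biSup_of_nonneg {α : Type*} {s : Set α} {g : α → ℝ} (hg : ∀ x, 0 ≤ g x) {C : ℝ}
    (hC : ∀ x ∈ s, g x ≤ C) {x : α} (hx : x ∈ s) : g x ≤ ⨆ y ∈ s, g y := by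
  have hbdd : BddAbove (Set.range fun y => ⨆ _ : y ∈ s, g y) := by
    refine ⟨C, ?_⟩
    rintro _ ⟨y, rfl⟩
    exact Real.iSup_le (hC y) ((hg x).trans (hC x hx))
  have h := le_ciSup hbdd x
  simpa only [ciSup_pos hx] using h

/-- Given a partition `K_1, …, K_N` (N ≥ 2) of compact sets with nonempty
interiors, pairwise disjoint interiors, pairwise connectedness, and regularity
(`closure (interior K_n) = K_n`), for every `δ > 0` there is an index `n ≠ 1`, with
`K_1 ∩ K_n ≠ ∅`, and constants `c₁, c_n ∈ ℝ^D` such that the piecewise-constant function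
`f_δ = c₁·1_{int K_1} + c_n·1_{int K_n}` is uniformly at distance at least `δ` (over `⋃ K_k`)
from every continuous function supported in `K_1 ∪ K_n`. -/
theorem ffnn_not_universal_partition
    {d D N : ℕ} (hD : 0 < D) (hN : 2 ≤ N)
    (X : Set (EuclideanSpace ℝ (Fin d))) (hX : IsCompact X)
    (K : Fin N → Set (EuclideanSpace ℝ (Fin d)))
    (hKc : ∀ n, IsCompact (K n))
    (hint : ∀ n, (interior (K n)).Nonempty)
    (hdisj : ∀ n m, n ≠ m → interior (K n) ∩ interior (K m) = ∅)
    (hconn : ∀ n : Fin N, ∃ m : Fin N, m ≠ n ∧ (K n ∩ K m).Nonempty)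
    (hreg : ∀ n, closure (interior (K n)) = K n)
    (δ : ℝ) (hδ : 0 < δ) :
    ∃ (n : Fin N) (c₁ cn : EuclideanSpace ℝ (Fin D)),
      n ≠ ⟨0, by omega⟩ ∧ (K ⟨0, by omega⟩ ∩ K n).Nonempty ∧
      ∀ f : EuclideanSpace ℝ (Fin d) → EuclideanSpace ℝ (Fin D),
        Continuous f → tsupport f ⊆ K ⟨0, by omega⟩ ∪ K n →
        δ ≤ ⨆ x ∈ ⋃ k, K k,
          ‖f x - ((interior (K ⟨0, by omega⟩)).indicator (fun _ => c₁) x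
            + (interior (K n)).indicator (fun _ => cn) x)‖ := by
  obtain ⟨n, hn, x₀, hx₀⟩ := hconn ⟨0, by omega⟩
  refine ⟨n, EuclideanSpace.single ⟨0, hD⟩ (2 * δ), 0, hn, ⟨x₀, hx₀⟩, fun f hf _ => ?_⟩
  generalize (⟨0, by omega⟩ : Fin N) = i at *
  set c : EuclideanSpace ℝ (Fin D) := EuclideanSpace.single ⟨0, hD⟩ (2 * δ) with hc
  have hcnorm : ‖c‖ = 2 * δ := by
    rw [hc, PiLp.norm_single, Real.norm_of_nonneg (by positivity)]
  simp only [Set.indicator_zero, add_zero]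
  obtain ⟨C, hC⟩ := (isCompact_iUnion hKc).exists_bound_of_continuousOn hf.continuousOn
  have hle {x} (hx : x ∈ ⋃ k, K k) :=
    Real.le_biSup_of_nonneg (s := ⋃ k, K k)
      (g := fun x => ‖f x - (interior (K i)).indicator (fun _ => c) x‖)
      (fun _ => norm_nonneg _)
      (fun y hy => (norm_sub_le _ _).trans
        (add_le_add (hC y hy) (norm_indicator_le_norm_self (fun _ => c) y))) hx
  have hmem {k x} (hx : x ∈ interior (K k)) : x ∈ ⋃ k, K k :=
    Set.mem_iUnion_of_mem k (interior_subset hx)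
  have key := norm_sub_le_two_mul_of_mem_closure hf (a := c) (b := 0)
    (A := interior (K i)) (B := interior (K n)) (x := x₀)
    (fun x hx => by simpa only [Set.indicator_of_mem hx] using hle (hmem hx))
    (fun x hx => by
      have hxi : x ∉ interior (K i) := fun h => (hdisj n i hn).subset ⟨hx, h⟩
      simpa only [Set.indicator_of_notMem hxi] using hle (hmem hx))
    ((hreg i).symm ▸ hx₀.1) ((hreg n).symm ▸ hx₀.2)
  rw [sub_zero, hcnorm] at key
  linarith
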